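/- arXiv:1707.08942 — 2 statements merged into one kernel-verified Lean document; each statement's English description precedes it below -/
import Mathlib

section
/- Let a > 0, let ν satisfy 0 < ν < 1/2, let λ satisfy −1/2 < λ < 1/2, and let ρ satisfy ν + |λ| < ρ < 1. Then ∫_0^∞ x^{ρ−1} K_ν(a x) K_λ(a x) dx = (2^{ρ−3}/a^{ρ}) · [ Γ(ν) Γ((ρ+λ−ν)/2) Γ((ρ−λ−ν)/2) Γ(1−ν) Γ(1−ρ) / ( Γ(1−(ρ+ν+λ)/2) Γ(1−(ρ+ν−λ)/2) ) + Γ(−ν) Γ((ρ+λ+ν)/2) Γ((ρ+ν−λ)/2) Γ(1+ν) Γ(1−ρ) / ( Γ(1−(ρ−ν−λ)/2) Γ(1−(ρ−ν+λ)/2) ) ]. -/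
open MeasureTheory Filter Set

lemma abs_integral_cos_mul_exp_neg_mul_sq_le {u T : ℝ} (hu : 0 < u) (hT : 0 ≤ T) :
    |∫ t in (0:ℝ)..T, Real.cos t * Real.exp (-u * t ^ 2)| ≤ 2 := by
  have hd : ∀ t : ℝ, HasDerivAt (fun t => Real.exp (-u * t ^ 2))
      (-(2 * u * t * Real.exp (-u * t ^ 2))) t := by
    intro t
    have := (((hasDerivAt_pow 2 t).const_mul (-u))).exp
    convert this using 1
    push_cast
    ring
  have hc : Continuous fun t : ℝ => 2 * u * t * Real.exp (-u * t ^ 2) := by fun_prop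
  have hparts := intervalIntegral.integral_mul_deriv_eq_deriv_mul (a := 0) (b := T)
    (fun t _ => hd t) (fun t _ => Real.hasDerivAt_sin t)
    (hc.neg.intervalIntegrable _ _) (Real.continuous_cos.intervalIntegrable _ _)
  have hval : ∫ t in (0:ℝ)..T, 2 * u * t * Real.exp (-u * t ^ 2) =
      1 - Real.exp (-u * T ^ 2) := by
    have := intervalIntegral.integral_eq_sub_of_hasDerivAt (a := 0) (b := T)
      (fun t _ => hd t) (hc.neg.intervalIntegrable _ _)
    rw [intervalIntegral.integral_neg] at this
    simp at this ⊢
    linarith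
  have hle : |∫ t in (0:ℝ)..T, -(2 * u * t * Real.exp (-u * t ^ 2)) * Real.sin t| ≤
      1 - Real.exp (-u * T ^ 2) := by
    rw [← hval, ← Real.norm_eq_abs]
    refine intervalIntegral.norm_integral_le_of_norm_le hT (ae_of_all _ fun t ht => ?_)
      (hc.intervalIntegrable _ _)
    have h0 : 0 ≤ 2 * u * t * Real.exp (-u * t ^ 2) := by
      have := ht.1.le
      positivity
    rw [norm_mul, norm_neg, Real.norm_of_nonneg h0]
    exact mul_le_of_le_one_right h0 (Real.abs_sin_le_one t)
  have hsin : |Real.exp (-u * T ^ 2) * Real.sin T| ≤ Real.exp (-u * T ^ 2) := by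
    rw [abs_mul, abs_of_pos (Real.exp_pos _)]
    exact mul_le_of_le_one_right (Real.exp_pos _).le (Real.abs_sin_le_one T)
  have heq : ∫ t in (0:ℝ)..T, Real.cos t * Real.exp (-u * t ^ 2) =
      Real.exp (-u * T ^ 2) * Real.sin T -
        ∫ t in (0:ℝ)..T, -(2 * u * t * Real.exp (-u * t ^ 2)) * Real.sin t := by
    simp_rw [mul_comm (Real.cos _)]
    rw [hparts]
    simp
  rw [heq]
  have := abs_sub (Real.exp (-u * T ^ 2) * Real.sin T)
    (∫ t in (0:ℝ)..T, -(2 * u * t * Real.exp (-u * t ^ 2)) * Real.sin t)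
  linarith

lemma tendsto_integral_cos_mul_exp_neg_mul_sq {u : ℝ} (hu : 0 < u) :
    Tendsto (fun T => ∫ t in (0:ℝ)..T, Real.cos t * Real.exp (-u * t ^ 2)) atTop
      (nhds (Real.sqrt (Real.pi / u) / 2 * Real.exp (-(1 / (4 * u))))) := by
  have hint : Integrable fun t : ℝ => Real.cos t * Real.exp (-u * t ^ 2) :=
    (integrable_exp_neg_mul_sq hu).bdd_mul (c := 1) (by fun_prop)
      (ae_of_all _ fun t => Real.abs_cos_le_one t)
  have hfull : ∫ t : ℝ, Real.cos t * Real.exp (-u * t ^ 2) =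
      Real.sqrt (Real.pi / u) * Real.exp (-(1 / (4 * u))) := by
    have h := fourierIntegral_gaussian (b := (u : ℂ)) (by simpa using hu) 1
    have hI : Integrable fun t : ℝ =>
        Complex.exp (Complex.I * 1 * t) * Complex.exp (-(u : ℂ) * (t : ℂ) ^ 2) := by
      refine (integrable_cexp_neg_mul_sq (b := (u : ℂ)) (by simpa using hu)).bdd_mul (c := 1)
        (by fun_prop) (ae_of_all _ fun t => ?_)
      rw [mul_one, mul_comm, Complex.norm_exp_ofReal_mul_I]
    have h2 := congrArg Complex.re h
    rw [← RCLike.re_eq_complex_re, ← integral_re hI] at h2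
    calc _ = ∫ t : ℝ, RCLike.re (Complex.exp (Complex.I * 1 * t) *
          Complex.exp (-(u : ℂ) * (t : ℂ) ^ 2)) := by
          congr 1 with t
          rw [show -(u : ℂ) * (t : ℂ) ^ 2 = ((-u * t ^ 2 : ℝ) : ℂ) by push_cast; ring,
            ← Complex.ofReal_exp, mul_one, mul_comm Complex.I]
          rw [RCLike.re_eq_complex_re, Complex.re_mul_ofReal, Complex.exp_ofReal_mul_I_re]
      _ = _ := by
          rw [h2, show -(1 : ℂ) ^ 2 / (4 * u) = ((-(1 / (4 * u)) : ℝ) : ℂ) by push_cast; ring,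
            ← Complex.ofReal_exp, ← Complex.ofReal_div,
            show (1 / 2 : ℂ) = ((1 / 2 : ℝ) : ℂ) by push_cast; rfl,
            ← Complex.ofReal_cpow (by positivity), ← Complex.ofReal_mul, Real.sqrt_eq_rpow]
          rfl
  have hhalf : ∫ t in Ioi (0:ℝ), Real.cos t * Real.exp (-u * t ^ 2) =
      Real.sqrt (Real.pi / u) / 2 * Real.exp (-(1 / (4 * u))) := by
    have := integral_comp_abs (f := fun t : ℝ => Real.cos t * Real.exp (-u * t ^ 2))
    simp only [Real.cos_abs, sq_abs, hfull] at this
    linarith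
  rw [← hhalf]
  exact intervalIntegral_tendsto_integral_Ioi 0 hint.integrableOn tendsto_id

lemma integrableOn_rpow_mul_exp_neg_mul {α c : ℝ} (hα : 0 < α) (hc : 0 < c) :
    IntegrableOn (fun u => u ^ (α - 1) * Real.exp (-(c * u))) (Ioi 0) := by
  by_contra h
  have := Real.integral_rpow_mul_exp_neg_mul_Ioi hα hc
  rw [integral_undef h] at this
  have h1 := Real.Gamma_pos_of_pos hα
  have : 0 < (1 / c) ^ α * Real.Gamma α := by positivity
  linarith

lemma lintegral_rpow_mul_exp_neg_mul {α c : ℝ} (hα : 0 < α) (hc : 0 < c) :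
    ∫⁻ u in Ioi (0:ℝ), ENNReal.ofReal (u ^ (α - 1) * Real.exp (-(c * u))) =
      ENNReal.ofReal (Real.Gamma α * c ^ (-α)) := by
  rw [← ofReal_integral_eq_lintegral_ofReal (integrableOn_rpow_mul_exp_neg_mul hα hc),
    Real.integral_rpow_mul_exp_neg_mul_Ioi hα hc, one_div, Real.inv_rpow hc.le,
    Real.rpow_neg hc.le, mul_comm]
  filter_upwards [ae_restrict_mem measurableSet_Ioi] with u hu
  have : (0:ℝ) < u := hu
  simp only [Pi.zero_apply]
  positivity

lemma lintegral_rpow_mul_exp_neg_mul_sq {β b : ℝ} (hβ : 0 < β) (hb : 0 < b) :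
    ∫⁻ x in Ioi (0:ℝ), ENNReal.ofReal (x ^ (2 * β - 1) * Real.exp (-(b * x ^ 2))) =
      ENNReal.ofReal (Real.Gamma β * b ^ (-β) / 2) := by
  have h := integral_rpow_mul_exp_neg_mul_rpow (p := 2) (q := 2 * β - 1) two_pos (by linarith) hb
  have hΓ := Real.Gamma_pos_of_pos hβ
  have e : (∫ x in Ioi (0:ℝ), x ^ (2 * β - 1) * Real.exp (-(b * x ^ 2))) =
      Real.Gamma β * b ^ (-β) / 2 := by
    simp only [Real.rpow_two, neg_mul] at h
    rw [h, show -(2 * β - 1 + 1) / 2 = -β by ring, show (2 * β - 1 + 1) / 2 = β by ring]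
    ring
  rw [← ofReal_integral_eq_lintegral_ofReal, e]
  · by_contra hI
    rw [integral_undef hI] at e
    have : 0 < Real.Gamma β * b ^ (-β) / 2 := by positivity
    linarith
  · filter_upwards [ae_restrict_mem measurableSet_Ioi] with u hu
    have : (0:ℝ) < u := hu
    simp only [Pi.zero_apply]
    positivity

lemma integral_cos_div_eq {ν x T : ℝ} (hν : -1/2 < ν) (hx : 0 < x) :
    ∫ t in (0:ℝ)..T, Real.cos t / (x ^ 2 + t ^ 2) ^ (ν + 1/2) =
      (Real.Gamma (ν + 1/2))⁻¹ * ∫ u in Ioi (0:ℝ), u ^ (ν + 1/2 - 1) * Real.exp (-(x ^ 2 * u)) *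
        ∫ t in (0:ℝ)..T, Real.cos t * Real.exp (-u * t ^ 2) := by
  have hα : 0 < ν + 1/2 := by linarith
  have hΓ := Real.Gamma_pos_of_pos hα
  have hpt : ∀ t : ℝ, Real.cos t / (x ^ 2 + t ^ 2) ^ (ν + 1/2) = (Real.Gamma (ν + 1/2))⁻¹ *
      ∫ u in Ioi (0:ℝ), u ^ (ν + 1/2 - 1) * Real.exp (-(x ^ 2 * u)) *
        (Real.cos t * Real.exp (-u * t ^ 2)) := by
    intro t
    have h0 : 0 < x ^ 2 + t ^ 2 := by positivity
    have := Real.integral_rpow_mul_exp_neg_mul_Ioi hα h0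
    calc _ = (Real.Gamma (ν + 1/2))⁻¹ * (Real.cos t *
          ((1 / (x ^ 2 + t ^ 2)) ^ (ν + 1/2) * Real.Gamma (ν + 1/2))) := by
          rw [Real.div_rpow zero_le_one h0.le, Real.one_rpow]
          generalize Real.Gamma (ν + 1/2) = G at *
          field_simp
      _ = _ := by
          rw [← this, ← integral_const_mul]
          congr 2 with u
          rw [show -((x ^ 2 + t ^ 2) * u) = -(x ^ 2 * u) + -u * t ^ 2 by ring, Real.exp_add]
          ring
  simp_rw [hpt]
  rw [intervalIntegral.integral_const_mul, intervalIntegral_integral_swap]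
  · simp_rw [intervalIntegral.integral_const_mul]
  · have hg := integrableOn_rpow_mul_exp_neg_mul hα (pow_pos hx 2)
    have h1 : Integrable (fun _ : ℝ => (1:ℝ)) (volume.restrict (uIoc 0 T)) := by
      simp [uIoc]
    refine (h1.mul_prod hg).mono (by fun_prop) ?_
    have : ∀ᵐ z : ℝ × ℝ ∂((volume.restrict (uIoc 0 T)).prod (volume.restrict (Ioi (0:ℝ)))),
        z.2 ∈ Ioi (0:ℝ) :=
      Measure.quasiMeasurePreserving_snd.ae (ae_restrict_mem measurableSet_Ioi)
    filter_upwards [this] with z hz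
    have hz : 0 < z.2 := hz
    simp only [Function.uncurry, norm_mul, one_mul]
    refine mul_le_of_le_one_right (by positivity) ?_
    refine mul_le_one₀ (Real.abs_cos_le_one _) (norm_nonneg _) ?_
    rw [Real.norm_of_nonneg (Real.exp_pos _).le, Real.exp_le_one_iff]
    have : 0 ≤ z.2 * z.1 ^ 2 := by positivity
    linarith

lemma basset_integral_eq {ν x k : ℝ} (hν : -1/2 < ν) (hx : 0 < x)
    (hk : Tendsto (fun T => ∫ t in (0:ℝ)..T, Real.cos t / (x ^ 2 + t ^ 2) ^ (ν + 1/2)) atTop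
      (nhds (Real.sqrt Real.pi * k / ((2 : ℝ) ^ ν * Real.Gamma (ν + 1/2) * x ^ ν)))) :
    IntegrableOn (fun p => p ^ (-ν - 1) * Real.exp (-(x ^ 2 / p) - p / 4)) (Ioi 0) ∧
      k = 2 ^ (ν - 1) * x ^ ν *
        ∫ p in Ioi (0:ℝ), p ^ (-ν - 1) * Real.exp (-(x ^ 2 / p) - p / 4) := by
  have hα : 0 < ν + 1/2 := by linarith
  have hΓ := Real.Gamma_pos_of_pos hα
  have hg := integrableOn_rpow_mul_exp_neg_mul hα (pow_pos hx 2)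
  have hcont : ∀ T : ℝ, Continuous fun u : ℝ =>
      ∫ t in (0:ℝ)..T, Real.cos t * Real.exp (-u * t ^ 2) := fun T =>
    intervalIntegral.continuous_parametric_intervalIntegral_of_continuous' (by fun_prop) _ _
  have hbound : ∀ u : ℝ, 0 < u → ∀ F : ℝ, |F| ≤ 2 →
      ‖u ^ (ν + 1/2 - 1) * Real.exp (-(x ^ 2 * u)) * F‖ ≤
        u ^ (ν + 1/2 - 1) * Real.exp (-(x ^ 2 * u)) * 2 := by
    intro u hu F hF
    rw [norm_mul, Real.norm_of_nonneg (by positivity)]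
    exact mul_le_mul_of_nonneg_left hF (by positivity)
  have hlim := tendsto_integral_filter_of_dominated_convergence
    (μ := volume.restrict (Ioi (0:ℝ))) (l := atTop)
    (F := fun (T : ℝ) u => u ^ (ν + 1/2 - 1) * Real.exp (-(x ^ 2 * u)) *
        ∫ t in (0:ℝ)..T, Real.cos t * Real.exp (-u * t ^ 2))
    (f := fun u => u ^ (ν + 1/2 - 1) * Real.exp (-(x ^ 2 * u)) *
        (Real.sqrt (Real.pi / u) / 2 * Real.exp (-(1 / (4 * u)))))
    (fun u => u ^ (ν + 1/2 - 1) * Real.exp (-(x ^ 2 * u)) * 2)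
    (Eventually.of_forall fun T => hg.aestronglyMeasurable.mul (hcont T).aestronglyMeasurable)
    (by
      filter_upwards [eventually_ge_atTop 0] with T hT
      filter_upwards [ae_restrict_mem measurableSet_Ioi] with u hu
      exact hbound u hu _ (abs_integral_cos_mul_exp_neg_mul_sq_le hu hT))
    (hg.mul_const 2)
    (by
      filter_upwards [ae_restrict_mem measurableSet_Ioi] with u hu
      exact (tendsto_integral_cos_mul_exp_neg_mul_sq hu).const_mul _)
  have hint : IntegrableOn (fun u => u ^ (ν + 1/2 - 1) * Real.exp (-(x ^ 2 * u)) *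
        (Real.sqrt (Real.pi / u) / 2 * Real.exp (-(1 / (4 * u))))) (Ioi 0) := by
    refine (hg.mul_const 2).mono' (by fun_prop) ?_
    filter_upwards [ae_restrict_mem measurableSet_Ioi] with u hu
    refine hbound u hu _ (le_of_tendsto (tendsto_integral_cos_mul_exp_neg_mul_sq hu).abs ?_)
    filter_upwards [eventually_ge_atTop 0] with T hT
    exact abs_integral_cos_mul_exp_neg_mul_sq_le hu hT
  have hpt : ∀ p ∈ Ioi (0:ℝ), (|(-1:ℝ)| * p ^ ((-1:ℝ) - 1)) •
      ((p ^ (-1:ℝ)) ^ (ν + 1/2 - 1) * Real.exp (-(x ^ 2 * p ^ (-1:ℝ))) *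
        (Real.sqrt (Real.pi / p ^ (-1:ℝ)) / 2 * Real.exp (-(1 / (4 * p ^ (-1:ℝ)))))) =
      Real.sqrt Real.pi / 2 * (p ^ (-ν - 1) * Real.exp (-(x ^ 2 / p) - p / 4)) := by
    intro p hp
    have hp : 0 < p := hp
    rw [← Real.rpow_mul hp.le, Real.rpow_neg_one, div_inv_eq_mul, Real.sqrt_mul Real.pi_pos.le,
      Real.sqrt_eq_rpow p, show -ν - 1 = ((-1:ℝ) - 1) + (-1) * (ν + 1/2 - 1) + 1/2 by ring,
      Real.rpow_add hp, Real.rpow_add hp,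
      show -(x ^ 2 / p) - p / 4 = -(x ^ 2 * p⁻¹) + -(1 / (4 * p⁻¹)) by
        field_simp; ring,
      Real.exp_add, abs_neg, abs_one, smul_eq_mul]
    ring
  have hcomp := (integrableOn_Ioi_comp_rpow_iff _ (by norm_num : (-1:ℝ) ≠ 0)).2 hint
  have hsq : 0 < Real.sqrt Real.pi := Real.sqrt_pos.2 Real.pi_pos
  have hJ : IntegrableOn (fun p => p ^ (-ν - 1) * Real.exp (-(x ^ 2 / p) - p / 4)) (Ioi 0) := by
    have := ((integrableOn_congr_fun hpt measurableSet_Ioi).1 hcomp).const_mul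
      (Real.sqrt Real.pi / 2)⁻¹
    refine this.congr (ae_of_all _ fun p => ?_)
    simp only
    rw [inv_mul_cancel_left₀ (by positivity)]
  refine ⟨hJ, ?_⟩
  have hval := integral_comp_rpow_Ioi (fun u : ℝ => u ^ (ν + 1/2 - 1) * Real.exp (-(x ^ 2 * u)) *
        (Real.sqrt (Real.pi / u) / 2 * Real.exp (-(1 / (4 * u))))) (by norm_num : (-1:ℝ) ≠ 0)
  rw [setIntegral_congr_fun measurableSet_Ioi hpt, integral_const_mul] at hval
  rw [← hval] at hlim
  have huniq := tendsto_nhds_unique hk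
    ((hlim.const_mul (Real.Gamma (ν + 1/2))⁻¹).congr fun T => (integral_cos_div_eq hν hx).symm)
  have h2 : (0:ℝ) < 2 ^ ν := by positivity
  have hxν : 0 < x ^ ν := by positivity
  rw [Real.rpow_sub_one two_ne_zero]
  generalize Real.Gamma (ν + 1/2) = G at *
  generalize (∫ p in Ioi (0:ℝ), p ^ (-ν - 1) * Real.exp (-(x ^ 2 / p) - p / 4)) = J at *
  field_simp at huniq ⊢
  linarith

lemma lintegral_ofReal_const_mul {α : Type*} [MeasurableSpace α] (μ : Measure α) {c : ℝ}
    (hc : 0 ≤ c) (f : α → ℝ) :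
    ∫⁻ a, ENNReal.ofReal (c * f a) ∂μ = ENNReal.ofReal c * ∫⁻ a, ENNReal.ofReal (f a) ∂μ := by
  simp_rw [ENNReal.ofReal_mul hc]
  exact lintegral_const_mul' _ _ ENNReal.ofReal_ne_top

lemma lintegral_rpow_mul_add_rpow_neg {s ρ c : ℝ} (hs : 0 < s) (hsρ : s < ρ) (hc : 0 < c) :
    ∫⁻ y in Ioi (0:ℝ), ENNReal.ofReal (y ^ (s - 1) * (c + y) ^ (-ρ)) =
      ENNReal.ofReal (Real.Gamma s * Real.Gamma (ρ - s) * c ^ (-(ρ - s)) / Real.Gamma ρ) := by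
  have hρ := hs.trans hsρ
  have hΓρ := Real.Gamma_pos_of_pos hρ
  have hΓs := Real.Gamma_pos_of_pos hs
  have hl : ∀ y ∈ Ioi (0:ℝ), ENNReal.ofReal (y ^ (s - 1) * (c + y) ^ (-ρ)) =
      ∫⁻ z in Ioi (0:ℝ), ENNReal.ofReal
        (y ^ (s - 1) / Real.Gamma ρ * (z ^ (ρ - 1) * Real.exp (-((c + y) * z)))) := by
    intro y hy
    have hy : 0 < y := hy
    rw [lintegral_ofReal_const_mul _ (by positivity),
      lintegral_rpow_mul_exp_neg_mul hρ (by positivity), ← ENNReal.ofReal_mul (by positivity)]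
    congr 1
    field_simp
  have hr : ∀ z ∈ Ioi (0:ℝ), (∫⁻ y in Ioi (0:ℝ), ENNReal.ofReal
        (y ^ (s - 1) / Real.Gamma ρ * (z ^ (ρ - 1) * Real.exp (-((c + y) * z))))) =
      ENNReal.ofReal
        (Real.Gamma s / Real.Gamma ρ * (z ^ (ρ - s - 1) * Real.exp (-(c * z)))) := by
    intro z hz
    have hz : 0 < z := hz
    calc _ = ∫⁻ y in Ioi (0:ℝ), ENNReal.ofReal (z ^ (ρ - 1) * Real.exp (-(c * z)) / Real.Gamma ρ *
          (y ^ (s - 1) * Real.exp (-(z * y)))) := by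
          congr 2 with y
          congr 1
          rw [show -((c + y) * z) = -(c * z) + -(z * y) by ring, Real.exp_add]
          ring
      _ = _ := by
          rw [lintegral_ofReal_const_mul _ (by positivity), lintegral_rpow_mul_exp_neg_mul hs hz,
            ← ENNReal.ofReal_mul (by positivity),
            show ρ - s - 1 = (ρ - 1) + -s by ring, Real.rpow_add hz]
          congr 1
          ring
  rw [setLIntegral_congr_fun measurableSet_Ioi hl, lintegral_lintegral_swap (by fun_prop),
    setLIntegral_congr_fun measurableSet_Ioi hr, lintegral_ofReal_const_mul _ (by positivity),
    lintegral_rpow_mul_exp_neg_mul (by linarith) hc, ← ENNReal.ofReal_mul (by positivity)]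
  congr 1
  ring

lemma lintegral_rpow_mul_integral_mul_integral {ν μ s : ℝ} (hs : 0 < s) (hν : ν < s) (hμ : μ < s)
    (hνμ : ν + μ < s)
    (hIν : ∀ x : ℝ, 0 < x →
      IntegrableOn (fun p => p ^ (-ν - 1) * Real.exp (-(x ^ 2 / p) - p / 4)) (Ioi 0))
    (hIμ : ∀ x : ℝ, 0 < x →
      IntegrableOn (fun p => p ^ (-μ - 1) * Real.exp (-(x ^ 2 / p) - p / 4)) (Ioi 0)) :
    ∫⁻ x in Ioi (0:ℝ), ENNReal.ofReal (x ^ (2 * s - 1) *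
        ((∫ p in Ioi (0:ℝ), p ^ (-ν - 1) * Real.exp (-(x ^ 2 / p) - p / 4)) *
          ∫ q in Ioi (0:ℝ), q ^ (-μ - 1) * Real.exp (-(x ^ 2 / q) - q / 4))) =
      ENNReal.ofReal (Real.Gamma (s - ν) * Real.Gamma (s - μ) * Real.Gamma s *
        Real.Gamma (s - ν - μ) * 4 ^ (s - ν - μ) / (2 * Real.Gamma (2 * s - ν - μ))) := by
  set P := (volume.restrict (Ioi (0:ℝ))).prod (volume.restrict (Ioi (0:ℝ))) with hP
  have hnn : ∀ κ x : ℝ,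
      0 ≤ᵐ[volume.restrict (Ioi (0:ℝ))]
        fun p => p ^ (-κ - 1) * Real.exp (-(x ^ 2 / p) - p / 4) := by
    intro κ x
    filter_upwards [ae_restrict_mem measurableSet_Ioi] with p hp
    have : (0:ℝ) < p := hp
    simp only [Pi.zero_apply]
    positivity
  have hpos1 : ∀ᵐ z ∂P, 0 < z.1 :=
    Measure.quasiMeasurePreserving_fst.ae (ae_restrict_mem measurableSet_Ioi)
  have hpos2 : ∀ᵐ z ∂P, 0 < z.2 :=
    Measure.quasiMeasurePreserving_snd.ae (ae_restrict_mem measurableSet_Ioi)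
  have hprod : ∀ x ∈ Ioi (0:ℝ), ENNReal.ofReal (x ^ (2 * s - 1) *
        ((∫ p in Ioi (0:ℝ), p ^ (-ν - 1) * Real.exp (-(x ^ 2 / p) - p / 4)) *
          ∫ q in Ioi (0:ℝ), q ^ (-μ - 1) * Real.exp (-(x ^ 2 / q) - q / 4))) =
      ∫⁻ z, ENNReal.ofReal (x ^ (2 * s - 1) *
        ((z.1 ^ (-ν - 1) * Real.exp (-(x ^ 2 / z.1) - z.1 / 4)) *
          (z.2 ^ (-μ - 1) * Real.exp (-(x ^ 2 / z.2) - z.2 / 4)))) ∂P := by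
    intro x hx
    have hx : 0 < x := hx
    rw [lintegral_ofReal_const_mul _ (by positivity), ENNReal.ofReal_mul (by positivity),
      ENNReal.ofReal_mul (integral_nonneg_of_ae (hnn ν x)),
      ofReal_integral_eq_lintegral_ofReal (hIν x hx) (hnn ν x),
      ofReal_integral_eq_lintegral_ofReal (hIμ x hx) (hnn μ x),
      ← lintegral_prod_mul (by fun_prop) (by fun_prop)]
    congr 1
    refine lintegral_congr_ae ?_
    filter_upwards [hpos1] with z hz
    exact (ENNReal.ofReal_mul (by positivity)).symm
  have hx_int : ∀ᵐ z ∂P, (∫⁻ x in Ioi (0:ℝ), ENNReal.ofReal (x ^ (2 * s - 1) *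
        ((z.1 ^ (-ν - 1) * Real.exp (-(x ^ 2 / z.1) - z.1 / 4)) *
          (z.2 ^ (-μ - 1) * Real.exp (-(x ^ 2 / z.2) - z.2 / 4))))) =
      ∫⁻ y in Ioi (0:ℝ), ENNReal.ofReal (y ^ (s - 1) / 2 *
        ((z.1 ^ (s - ν - 1) * Real.exp (-((1 / 4 + y) * z.1))) *
          (z.2 ^ (s - μ - 1) * Real.exp (-((1 / 4 + y) * z.2))))) := by
    filter_upwards [hpos1, hpos2] with z h1 h2
    have hsum : 0 < z.1⁻¹ + z.2⁻¹ := by positivity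
    calc _ = ∫⁻ x in Ioi (0:ℝ), ENNReal.ofReal
          (z.1 ^ (-ν - 1) * z.2 ^ (-μ - 1) * Real.exp (-(z.1 / 4) - z.2 / 4) *
          (x ^ (2 * s - 1) * Real.exp (-((z.1⁻¹ + z.2⁻¹) * x ^ 2)))) := by
          congr 2 with x
          rw [show -(x ^ 2 / z.1) - z.1 / 4 = -(x ^ 2 / z.1) + -(z.1 / 4) by ring,
            show -(x ^ 2 / z.2) - z.2 / 4 = -(x ^ 2 / z.2) + -(z.2 / 4) by ring,
            show -(z.1 / 4) - z.2 / 4 = -(z.1 / 4) + -(z.2 / 4) by ring,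
            show -((z.1⁻¹ + z.2⁻¹) * x ^ 2) = -(x ^ 2 / z.1) + -(x ^ 2 / z.2) by ring]
          simp only [Real.exp_add]
          congr 1
          ring
      _ = ENNReal.ofReal (z.1 ^ (s - ν - 1) * z.2 ^ (s - μ - 1) / 2 *
            Real.exp (-(z.1 / 4) - z.2 / 4) * (Real.Gamma s * (z.1 + z.2) ^ (-s))) := by
          rw [lintegral_ofReal_const_mul _ (by positivity),
            lintegral_rpow_mul_exp_neg_mul_sq hs hsum, ← ENNReal.ofReal_mul (by positivity),
            show z.1⁻¹ + z.2⁻¹ = (z.1 + z.2) * (z.1⁻¹ * z.2⁻¹) by field_simp; ring,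
            Real.mul_rpow (by positivity) (by positivity),
            Real.mul_rpow (by positivity) (by positivity), Real.inv_rpow h1.le,
            Real.inv_rpow h2.le, Real.rpow_neg h1.le, Real.rpow_neg h2.le, inv_inv, inv_inv,
            show s - ν - 1 = s + (-ν - 1) by ring, show s - μ - 1 = s + (-μ - 1) by ring,
            Real.rpow_add h1, Real.rpow_add h2]
          congr 1
          ring
      _ = _ := by
          rw [ENNReal.ofReal_mul (by positivity),
            ← lintegral_rpow_mul_exp_neg_mul hs (by positivity : 0 < z.1 + z.2),
            ← lintegral_ofReal_const_mul _ (by positivity)]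
          congr 2 with y
          rw [show -((1 / 4 + y) * z.1) = -(z.1 / 4) + -(z.1 * y) by ring,
            show -((1 / 4 + y) * z.2) = -(z.2 / 4) + -(z.2 * y) by ring,
            show -(z.1 / 4) - z.2 / 4 = -(z.1 / 4) + -(z.2 / 4) by ring,
            show -((z.1 + z.2) * y) = -(z.1 * y) + -(z.2 * y) by ring]
          simp only [Real.exp_add]
          congr 1
          ring
  have hΓν := Real.Gamma_pos_of_pos (sub_pos.2 hν)
  have hΓμ := Real.Gamma_pos_of_pos (sub_pos.2 hμ)
  have hz_int : ∀ y ∈ Ioi (0:ℝ), (∫⁻ z, ENNReal.ofReal (y ^ (s - 1) / 2 *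
        ((z.1 ^ (s - ν - 1) * Real.exp (-((1 / 4 + y) * z.1))) *
          (z.2 ^ (s - μ - 1) * Real.exp (-((1 / 4 + y) * z.2))))) ∂P) =
      ENNReal.ofReal (Real.Gamma (s - ν) * Real.Gamma (s - μ) / 2 *
        (y ^ (s - 1) * (1 / 4 + y) ^ (-(2 * s - ν - μ)))) := by
    intro y hy
    have hy : 0 < y := hy
    have hy4 : 0 < 1 / 4 + y := by positivity
    have : (∫⁻ z, ENNReal.ofReal ((z.1 ^ (s - ν - 1) * Real.exp (-((1 / 4 + y) * z.1))) *
          (z.2 ^ (s - μ - 1) * Real.exp (-((1 / 4 + y) * z.2)))) ∂P) =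
        ∫⁻ z, ENNReal.ofReal (z.1 ^ (s - ν - 1) * Real.exp (-((1 / 4 + y) * z.1))) *
          ENNReal.ofReal (z.2 ^ (s - μ - 1) * Real.exp (-((1 / 4 + y) * z.2))) ∂P := by
      refine lintegral_congr_ae ?_
      filter_upwards [hpos1] with z hz
      rw [ENNReal.ofReal_mul (by positivity)]
    rw [lintegral_ofReal_const_mul _ (by positivity), this,
      lintegral_prod_mul (f := fun p =>
        ENNReal.ofReal (p ^ (s - ν - 1) * Real.exp (-((1 / 4 + y) * p))))
        (g := fun p => ENNReal.ofReal (p ^ (s - μ - 1) * Real.exp (-((1 / 4 + y) * p))))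
        (by fun_prop) (by fun_prop),
      lintegral_rpow_mul_exp_neg_mul (sub_pos.2 hν) hy4,
      lintegral_rpow_mul_exp_neg_mul (sub_pos.2 hμ) hy4, ← ENNReal.ofReal_mul (by positivity),
      ← ENNReal.ofReal_mul (by positivity),
      show -(2 * s - ν - μ) = -(s - ν) + -(s - μ) by ring, Real.rpow_add hy4]
    congr 1
    ring
  rw [setLIntegral_congr_fun measurableSet_Ioi hprod, lintegral_lintegral_swap (by fun_prop),
    lintegral_congr_ae hx_int, lintegral_lintegral_swap (by fun_prop),
    setLIntegral_congr_fun measurableSet_Ioi hz_int, lintegral_ofReal_const_mul _ (by positivity),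
    lintegral_rpow_mul_add_rpow_neg hs (by linarith) (by norm_num),
    ← ENNReal.ofReal_mul (by positivity), one_div, Real.inv_rpow (by norm_num),
    Real.rpow_neg (by norm_num), inv_inv, show 2 * s - ν - μ - s = s - ν - μ by ring]
  congr 1
  ring

lemma Gamma_mul_Gamma_add_Gamma_mul_Gamma_eq {ν μ ρ : ℝ} (hν : 0 < ν) (hν1 : ν < 1)
    (hρ0 : 0 < ρ) (hρ1 : ρ < 1)
    (h1 : 0 < ρ + μ - ν) (h2 : 0 < ρ - μ - ν) :
    Real.Gamma ν * Real.Gamma ((ρ + μ - ν) / 2) * Real.Gamma ((ρ - μ - ν) / 2) *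
          Real.Gamma (1 - ν) * Real.Gamma (1 - ρ) /
          (Real.Gamma (1 - (ρ + ν + μ) / 2) * Real.Gamma (1 - (ρ + ν - μ) / 2))
        + Real.Gamma (-ν) * Real.Gamma ((ρ + μ + ν) / 2) * Real.Gamma ((ρ + ν - μ) / 2) *
          Real.Gamma (1 + ν) * Real.Gamma (1 - ρ) /
          (Real.Gamma (1 - (ρ - ν - μ) / 2) * Real.Gamma (1 - (ρ - ν + μ) / 2)) =
      Real.Gamma ((ρ + ν + μ) / 2) * Real.Gamma ((ρ + ν - μ) / 2) *
        Real.Gamma ((ρ - ν + μ) / 2) * Real.Gamma ((ρ - ν - μ) / 2) / Real.Gamma ρ := by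
  have hπ := Real.pi_pos
  have hsinpos : ∀ x : ℝ, 0 < x → x < 1 → 0 < Real.sin (Real.pi * x) := fun x h0 h1 =>
    Real.sin_pos_of_pos_of_lt_pi (by positivity) (by nlinarith)
  have hrefl : ∀ x : ℝ, 0 < x → x < 1 →
      (Real.Gamma (1 - x))⁻¹ = Real.Gamma x * Real.sin (Real.pi * x) / Real.pi := by
    intro x h0 h1
    have h := Real.Gamma_mul_Gamma_one_sub x
    have hs := hsinpos x h0 h1
    have := Real.Gamma_pos_of_pos (by linarith : 0 < 1 - x)
    rw [eq_div_iff hs.ne'] at h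
    rw [inv_eq_iff_eq_inv, inv_div, eq_div_iff (by
      have := Real.Gamma_pos_of_pos h0
      positivity)]
    linarith
  have hsν := hsinpos ν hν hν1
  have hsρ := hsinpos ρ hρ0 hρ1
  have hΓρ := Real.Gamma_pos_of_pos hρ0
  have e1 : Real.Gamma (1 - ν) = Real.pi / (Real.Gamma ν * Real.sin (Real.pi * ν)) := by
    rw [← inv_inj, hrefl ν hν hν1, inv_div]
  have e2 : Real.Gamma (1 - ρ) = Real.pi / (Real.Gamma ρ * Real.sin (Real.pi * ρ)) := by
    rw [← inv_inj, hrefl ρ hρ0 hρ1, inv_div]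
  have e3 : Real.Gamma (-ν) * Real.Gamma (1 + ν) = -(Real.pi / Real.sin (Real.pi * ν)) := by
    have h := Real.Gamma_mul_Gamma_one_sub (-ν)
    rw [sub_neg_eq_add] at h
    rw [h, mul_neg, Real.sin_neg, div_neg]
  have htrig : Real.sin (Real.pi * ((ρ + ν + μ) / 2)) * Real.sin (Real.pi * ((ρ + ν - μ) / 2)) -
      Real.sin (Real.pi * ((ρ - ν - μ) / 2)) * Real.sin (Real.pi * ((ρ - ν + μ) / 2)) =
      Real.sin (Real.pi * ρ) * Real.sin (Real.pi * ν) := by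
    have key : ∀ a b : ℝ, Real.sin a * Real.sin b = (Real.cos (a - b) - Real.cos (a + b)) / 2 := by
      intro a b
      rw [Real.cos_sub, Real.cos_add]
      ring
    rw [key, key, key,
      show Real.pi * ((ρ + ν + μ) / 2) - Real.pi * ((ρ + ν - μ) / 2) = Real.pi * μ by ring,
      show Real.pi * ((ρ - ν - μ) / 2) - Real.pi * ((ρ - ν + μ) / 2) = -(Real.pi * μ) by ring,
      show Real.pi * ((ρ + ν + μ) / 2) + Real.pi * ((ρ + ν - μ) / 2) =
        Real.pi * ρ + Real.pi * ν by ring,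
      show Real.pi * ((ρ - ν - μ) / 2) + Real.pi * ((ρ - ν + μ) / 2) =
        Real.pi * ρ - Real.pi * ν by ring, Real.cos_neg]
    ring
  have hΓν := Real.Gamma_pos_of_pos hν
  rw [div_eq_mul_inv, div_eq_mul_inv _ (Real.Gamma (1 - (ρ - ν - μ) / 2) * _), mul_inv, mul_inv,
    hrefl _ (by linarith) (by linarith), hrefl _ (by linarith) (by linarith),
    hrefl _ (by linarith) (by linarith), hrefl _ (by linarith) (by linarith)]
  rw [show ρ + μ - ν = ρ - ν + μ by ring, show ρ - μ - ν = ρ - ν - μ by ring,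
    show ρ + μ + ν = ρ + ν + μ by ring, e1, e2]
  generalize Real.Gamma ((ρ + ν + μ) / 2) = A
  generalize Real.Gamma ((ρ + ν - μ) / 2) = B
  generalize Real.Gamma ((ρ - ν + μ) / 2) = C
  generalize Real.Gamma ((ρ - ν - μ) / 2) = D
  generalize Real.sin (Real.pi * ((ρ + ν + μ) / 2)) = sA at *
  generalize Real.sin (Real.pi * ((ρ + ν - μ) / 2)) = sB at *
  generalize Real.sin (Real.pi * ((ρ - ν + μ) / 2)) = sC at *
  generalize Real.sin (Real.pi * ((ρ - ν - μ) / 2)) = sD at *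
  generalize Real.sin (Real.pi * ν) = sν at *
  generalize Real.sin (Real.pi * ρ) = sρ at *
  generalize Real.Gamma ν = G at *
  generalize Real.Gamma ρ = R at *
  generalize Real.Gamma (-ν) = E at *
  generalize Real.Gamma (1 + ν) = F at *
  calc _ = A * B * C * D / (Real.pi * R * sρ) * (Real.pi / sν * (sA * sB) + E * F * (sD * sC)) := by
        field_simp
    _ = A * B * C * D / (R * sρ * sν) * (sA * sB - sD * sC) := by
        rw [e3]
        field_simp
        ring
    _ = _ := by
        rw [htrig]
        field_simp

theorem stmt_17 (K : ℝ → ℝ → ℝ)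
    (hK : ∀ ν : ℝ, -1/2 < ν → ∀ x : ℝ, 0 < x →
      Tendsto (fun T => ∫ t in (0:ℝ)..T, Real.cos t / (x ^ 2 + t ^ 2) ^ (ν + 1/2))
        atTop
        (nhds (Real.sqrt Real.pi * K ν x /
          ((2 : ℝ) ^ ν * Real.Gamma (ν + 1/2) * x ^ ν))))
    (a ν lam ρ : ℝ) (ha : 0 < a)
    (hν0 : 0 < ν) (hν : ν < 1/2) (hlam1 : -1/2 < lam) (hlam2 : lam < 1/2)
    (hρ1 : ν + |lam| < ρ) (hρ2 : ρ < 1) :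
    ∫ x in Ioi (0:ℝ), x ^ (ρ - 1) * K ν (a * x) * K lam (a * x) =
      ((2 : ℝ) ^ (ρ - 3) / a ^ ρ) *
        (Real.Gamma ν * Real.Gamma ((ρ + lam - ν) / 2) * Real.Gamma ((ρ - lam - ν) / 2) *
            Real.Gamma (1 - ν) * Real.Gamma (1 - ρ) /
            (Real.Gamma (1 - (ρ + ν + lam) / 2) * Real.Gamma (1 - (ρ + ν - lam) / 2))
          + Real.Gamma (-ν) * Real.Gamma ((ρ + lam + ν) / 2) * Real.Gamma ((ρ + ν - lam) / 2) *
            Real.Gamma (1 + ν) * Real.Gamma (1 - ρ) /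
            (Real.Gamma (1 - (ρ - ν - lam) / 2) * Real.Gamma (1 - (ρ - ν + lam) / 2))) := by
  have hmm := abs_lt.1 (lt_sub_iff_add_lt'.2 hρ1)
  have hρ0 : 0 < ρ := by linarith [abs_nonneg lam]
  rw [Gamma_mul_Gamma_add_Gamma_mul_Gamma_eq hν0 (by linarith) hρ0 hρ2 (by linarith [hmm.1])
    (by linarith [hmm.2])]
  set s := (ρ + ν + lam) / 2 with hs
  have hs0 : 0 < s := by linarith [hmm.1]
  have hKν := fun x hx => basset_integral_eq (by linarith) hx (hK ν (by linarith) x hx)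
  have hKlam := fun x hx => basset_integral_eq hlam1 hx (hK lam hlam1 x hx)
  have hscale := integral_comp_mul_left_Ioi (fun x => x ^ (ρ - 1) * K ν x * K lam x) 0 ha
  have hlhs : ∫ x in Ioi (0:ℝ), x ^ (ρ - 1) * K ν (a * x) * K lam (a * x) =
      a ^ (-ρ) * ∫ x in Ioi (0:ℝ), x ^ (ρ - 1) * K ν x * K lam x := by
    calc _ = a ^ (1 - ρ) *
          ∫ x in Ioi (0:ℝ), (a * x) ^ (ρ - 1) * K ν (a * x) * K lam (a * x) := by
          rw [← integral_const_mul]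
          refine setIntegral_congr_fun measurableSet_Ioi fun x hx => ?_
          have hx : 0 < x := hx
          rw [Real.mul_rpow ha.le hx.le, show 1 - ρ = -(ρ - 1) by ring, Real.rpow_neg ha.le]
          have : a ^ (ρ - 1) ≠ 0 := by positivity
          field_simp
      _ = _ := by
          rw [hscale, mul_zero, smul_eq_mul, ← mul_assoc, show 1 - ρ = -ρ + 1 by ring,
            Real.rpow_add_one ha.ne', mul_inv_cancel_right₀ ha.ne']
  have hunit : ∫ x in Ioi (0:ℝ), x ^ (ρ - 1) * K ν x * K lam x = 2 ^ (ν - 1) * 2 ^ (lam - 1) *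
      ∫ x in Ioi (0:ℝ), x ^ (2 * s - 1) *
        ((∫ p in Ioi (0:ℝ), p ^ (-ν - 1) * Real.exp (-(x ^ 2 / p) - p / 4)) *
          ∫ q in Ioi (0:ℝ), q ^ (-lam - 1) * Real.exp (-(x ^ 2 / q) - q / 4)) := by
    rw [← integral_const_mul]
    refine setIntegral_congr_fun measurableSet_Ioi fun x hx => ?_
    have hx : 0 < x := hx
    rw [(hKν x hx).2, (hKlam x hx).2, show 2 * s - 1 = ρ - 1 + ν + lam by rw [hs]; ring,
      Real.rpow_add hx, Real.rpow_add hx]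
    ring
  have hmeas : ∀ κ : ℝ, StronglyMeasurable fun x : ℝ =>
      ∫ p in Ioi (0:ℝ), p ^ (-κ - 1) * Real.exp (-(x ^ 2 / p) - p / 4) := fun κ =>
    StronglyMeasurable.integral_prod_right (Measurable.stronglyMeasurable (by fun_prop))
  have hnonneg : ∀ κ x : ℝ,
      0 ≤ ∫ p in Ioi (0:ℝ), p ^ (-κ - 1) * Real.exp (-(x ^ 2 / p) - p / 4) := fun κ x =>
    setIntegral_nonneg measurableSet_Ioi fun p hp =>
      mul_nonneg (Real.rpow_nonneg (le_of_lt hp) _) (Real.exp_pos _).le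
  have hΓ : ∀ x : ℝ, 0 < x → 0 ≤ Real.Gamma x := fun x hx => (Real.Gamma_pos_of_pos hx).le
  rw [hlhs, hunit, integral_eq_lintegral_of_nonneg_ae,
    lintegral_rpow_mul_integral_mul_integral hs0 (by linarith [hmm.1]) (by linarith [hmm.2])
      (by linarith [hmm.2]) (fun x hx => (hKν x hx).1) (fun x hx => (hKlam x hx).1),
    ENNReal.toReal_ofReal, show s - ν = (ρ - ν + lam) / 2 by rw [hs]; ring,
    show s - lam = (ρ + ν - lam) / 2 by rw [hs]; ring,
    show (ρ - ν + lam) / 2 - lam = (ρ - ν - lam) / 2 by ring,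
    show 2 * s - ν - lam = ρ by rw [hs]; ring]
  · have h4 : (4:ℝ) ^ ((ρ - ν - lam) / 2) = 2 ^ (ρ - ν - lam) := by
      rw [show (4:ℝ) = 2 ^ (2:ℝ) by norm_num, ← Real.rpow_mul two_pos.le]
      congr 1
      ring
    have h2 : (2:ℝ) ^ (ρ - 3) = 2 ^ (ν - 1) * 2 ^ (lam - 1) * 2 ^ (ρ - ν - lam) / 2 := by
      rw [← Real.rpow_add two_pos, ← Real.rpow_add two_pos, ← Real.rpow_sub_one two_ne_zero]
      congr 1
      ring
    rw [h4, h2, Real.rpow_neg ha.le]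
    ring
  · have := hΓ s hs0
    have := hΓ (s - ν) (by linarith [hmm.1])
    have := hΓ (s - lam) (by linarith [hmm.2])
    have := hΓ (s - ν - lam) (by linarith [hmm.2])
    have := hΓ (2 * s - ν - lam) (by linarith)
    positivity
  · filter_upwards [ae_restrict_mem measurableSet_Ioi] with x hx
    exact mul_nonneg (Real.rpow_nonneg (le_of_lt hx) _) (mul_nonneg (hnonneg _ _) (hnonneg _ _))
  · exact ((by fun_prop : Measurable fun x : ℝ => x ^ (2 * s - 1)).stronglyMeasurable.mul
      ((hmeas ν).mul (hmeas lam))).aestronglyMeasurable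
end

section
/- Let a > 0 and let ν, λ satisfy −1/2 < ν < 1/2, ν ≠ 0, and −1/2 < λ < 1/2. Then ∫_0^∞ K_ν(a x) K_λ(a x) dx = (π²/(4a sin(πν))) · [ tan(π(λ+ν)/2) − tan(π(λ−ν)/2) ]. -/
open MeasureTheory Filter Set

open scoped ENNReal

theorem setLIntegral_ofReal_eq_of_integral_eq {f : ℝ → ℝ} {c : ℝ} (hf : ∀ x ∈ Ioi (0 : ℝ), 0 ≤ f x)
    (hc : 0 < c) (h : ∫ x in Ioi (0 : ℝ), f x = c) :
    ∫⁻ x in Ioi (0 : ℝ), ENNReal.ofReal (f x) = ENNReal.ofReal c := by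
  have hi : IntegrableOn f (Ioi 0) := Integrable.of_integral_ne_zero (by rw [h]; exact hc.ne')
  rw [← h, ofReal_integral_eq_lintegral_ofReal hi]
  exact (ae_restrict_iff' measurableSet_Ioi).2 (.of_forall hf)

theorem setLIntegral_rpow_mul_exp_neg_mul_rpow {p q b : ℝ} (hp : 0 < p) (hq : -1 < q)
    (hb : 0 < b) :
    ∫⁻ x in Ioi (0 : ℝ), ENNReal.ofReal (x ^ q * Real.exp (-b * x ^ p)) =
      ENNReal.ofReal (b ^ (-(q + 1) / p) * (1 / p) * Real.Gamma ((q + 1) / p)) := by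
  apply setLIntegral_ofReal_eq_of_integral_eq _ _ (integral_rpow_mul_exp_neg_mul_rpow hp hq hb)
  · intro x hx
    have := Real.rpow_nonneg (le_of_lt hx) q
    positivity
  · have := Real.Gamma_pos_of_pos (s := (q + 1) / p) (by apply div_pos <;> linarith)
    positivity

theorem setLIntegral_exp_neg_mul {b : ℝ} (hb : 0 < b) :
    ∫⁻ x in Ioi (0 : ℝ), ENNReal.ofReal (Real.exp (-b * x)) = ENNReal.ofReal (1 / b) := by
  simpa [Real.rpow_neg_one] using
    setLIntegral_rpow_mul_exp_neg_mul_rpow (p := 1) (q := 0) one_pos (by norm_num) hb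

theorem setLIntegral_rpow_div_one_add_mul_rpow {p q w : ℝ} (hq : -1 < q) (hqp : q + 1 < p)
    (hw : 0 < w) :
    ∫⁻ x in Ioi (0 : ℝ), ENNReal.ofReal (x ^ q / (1 + w * x ^ p)) =
      ENNReal.ofReal (w ^ (-(q + 1) / p) * (1 / p) *
        (Real.pi / Real.sin (Real.pi * ((q + 1) / p)))) := by
  have hp : 0 < p := by linarith
  set s := (q + 1) / p with hs
  have hs0 : 0 < s := div_pos (by linarith) hp
  have hs1 : s < 1 := (div_lt_one hp).2 hqp
  have hns : -(q + 1) / p = -s := by rw [hs, neg_div]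
  have hG := Real.Gamma_pos_of_pos hs0
  calc
    _ = ∫⁻ x in Ioi (0 : ℝ), ∫⁻ t in Ioi (0 : ℝ),
          ENNReal.ofReal (Real.exp (-t) * (x ^ q * Real.exp (-(t * w) * x ^ p))) := by
      refine setLIntegral_congr_fun measurableSet_Ioi fun x hx ↦ ?_
      have hxq := Real.rpow_nonneg (le_of_lt hx) q
      have hxp := Real.rpow_nonneg (le_of_lt hx) p
      have hb : 0 < 1 + w * x ^ p := by positivity
      rw [div_eq_mul_one_div, ENNReal.ofReal_mul hxq, ← setLIntegral_exp_neg_mul hb,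
        ← lintegral_const_mul' _ _ ENNReal.ofReal_ne_top]
      refine lintegral_congr fun t ↦ ?_
      rw [← ENNReal.ofReal_mul hxq, mul_left_comm, ← Real.exp_add]
      ring_nf
    _ = ∫⁻ t in Ioi (0 : ℝ), ∫⁻ x in Ioi (0 : ℝ),
          ENNReal.ofReal (Real.exp (-t) * (x ^ q * Real.exp (-(t * w) * x ^ p))) :=
      lintegral_lintegral_swap (by unfold Function.uncurry; fun_prop)
    _ = ∫⁻ t in Ioi (0 : ℝ), ENNReal.ofReal (w ^ (-s) * (1 / p) * Real.Gamma s) *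
          ENNReal.ofReal (t ^ (-s) * Real.exp (-1 * t ^ (1 : ℝ))) := by
      refine setLIntegral_congr_fun measurableSet_Ioi fun t (ht : 0 < t) ↦ ?_
      simp only [ENNReal.ofReal_mul (Real.exp_pos (-t)).le]
      rw [lintegral_const_mul' _ _ ENNReal.ofReal_ne_top,
        setLIntegral_rpow_mul_exp_neg_mul_rpow hp hq (mul_pos ht hw), hns,
        Real.mul_rpow ht.le hw.le, ← ENNReal.ofReal_mul (by positivity),
        ← ENNReal.ofReal_mul (by positivity), Real.rpow_one, neg_one_mul]
      congr 1
      ring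
    _ = _ := by
      rw [lintegral_const_mul' _ _ ENNReal.ofReal_ne_top,
        setLIntegral_rpow_mul_exp_neg_mul_rpow one_pos (by linarith) one_pos,
        ← ENNReal.ofReal_mul (by positivity), ← Real.Gamma_mul_Gamma_one_sub, hns, Real.one_rpow]
      ring_nf

theorem setLIntegral_Ioi_eq_mul_comp_mul_left (f : ℝ → ℝ≥0∞) {u : ℝ} (hu : 0 < u) :
    ∫⁻ x in Ioi (0 : ℝ), f x = ENNReal.ofReal u * ∫⁻ x in Ioi (0 : ℝ), f (u * x) := by
  have h := lintegral_image_eq_lintegral_abs_deriv_mul (s := Ioi (0 : ℝ)) (f := fun x ↦ u * x)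
    (f' := fun _ ↦ u) measurableSet_Ioi
    (fun x _ ↦ by simpa using ((hasDerivAt_id x).const_mul u).hasDerivWithinAt)
    (mul_right_injective₀ hu.ne').injOn f
  rw [Set.image_mul_left_Ioi hu, mul_zero] at h
  rw [h, lintegral_const_mul' _ _ ENNReal.ofReal_ne_top, abs_of_pos hu]

theorem integral_Ioi_cos_mul_exp_neg_mul_sq {s : ℝ} (hs : 0 < s) :
    ∫ t in Ioi (0 : ℝ), Real.cos t * Real.exp (-s * t ^ 2) =
      √(Real.pi / s) / 2 * Real.exp (-1 / (4 * s)) := by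
  have h := fourierIntegral_gaussian (b := s) (by simpa using hs) 1
  have hInt : Integrable fun t : ℝ ↦
      Complex.exp (Complex.I * 1 * t) * Complex.exp (-s * t ^ 2) := by
    refine Integrable.of_integral_ne_zero ?_
    rw [h]
    have : (Real.pi / s : ℂ) ≠ 0 := by
      exact_mod_cast (div_pos Real.pi_pos hs).ne'
    simp [Complex.exp_ne_zero, Complex.cpow_eq_zero_iff, this]
  have hre := congrArg Complex.re h
  have hr : ((Real.pi / s : ℂ) ^ (1 / 2 : ℂ) * Complex.exp (-1 ^ 2 / (4 * s))).re =
      √(Real.pi / s) * Real.exp (-1 / (4 * s)) := by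
    rw [Real.sqrt_eq_rpow, ← Complex.ofReal_re (_ * _), Complex.ofReal_mul,
      Complex.ofReal_cpow (div_pos Real.pi_pos hs).le]
    push_cast
    norm_num
  rw [hr, ← RCLike.re_eq_complex_re, ← integral_re hInt] at hre
  have habs := integral_comp_abs (f := fun t ↦ Real.cos t * Real.exp (-s * t ^ 2))
  have hcongr : ∀ t : ℝ, Real.cos |t| * Real.exp (-s * |t| ^ 2) =
      RCLike.re (Complex.exp (Complex.I * 1 * t) * Complex.exp (-s * t ^ 2)) := by
    intro t
    rw [Real.cos_abs, sq_abs, mul_one, mul_comm Complex.I,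
      show (-s * t ^ 2 : ℂ) = ((-s * t ^ 2 : ℝ) : ℂ) by push_cast; ring, ← Complex.ofReal_exp,
      RCLike.re_eq_complex_re, Complex.re_mul_ofReal, Complex.exp_ofReal_mul_I_re]
  simp only [hcongr, hre] at habs
  linarith

theorem integrableOn_cos_mul_exp_neg_mul_sq {s : ℝ} (hs : 0 < s) :
    IntegrableOn (fun t ↦ Real.cos t * Real.exp (-s * t ^ 2)) (Ioi 0) := by
  refine Integrable.of_integral_ne_zero ?_
  rw [integral_Ioi_cos_mul_exp_neg_mul_sq hs]
  have := Real.pi_pos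
  positivity

theorem abs_intervalIntegral_cos_mul_exp_neg_mul_sq_le {s T : ℝ} (hs : 0 < s) (hT : 0 ≤ T) :
    |∫ t in (0 : ℝ)..T, Real.cos t * Real.exp (-s * t ^ 2)| ≤ 1 := by
  have hexp (t : ℝ) : HasDerivAt (fun t ↦ Real.exp (-s * t ^ 2))
      (Real.exp (-s * t ^ 2) * (-s * (2 * t))) t := by
    simpa using ((hasDerivAt_pow 2 t).const_mul (-s)).exp
  have hparts := intervalIntegral.integral_mul_deriv_eq_deriv_mul (a := 0) (b := T)
    (fun t _ ↦ hexp t) (fun t _ ↦ Real.hasDerivAt_sin t)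
    ((by fun_prop : Continuous _).intervalIntegrable _ _)
    ((by fun_prop : Continuous _).intervalIntegrable _ _)
  have hbound : |∫ t in (0 : ℝ)..T, Real.exp (-s * t ^ 2) * (-s * (2 * t)) * Real.sin t| ≤
      ∫ t in (0 : ℝ)..T, -(Real.exp (-s * t ^ 2) * (-s * (2 * t))) := by
    rw [← Real.norm_eq_abs]
    refine intervalIntegral.norm_integral_le_of_norm_le hT (.of_forall fun t ht ↦ ?_)
      ((by fun_prop : Continuous _).intervalIntegrable _ _)
    have ht0 : 0 < t := ht.1
    have hneg : Real.exp (-s * t ^ 2) * (-s * (2 * t)) ≤ 0 := by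
      have : 0 ≤ Real.exp (-s * t ^ 2) * (s * (2 * t)) := by positivity
      linarith
    rw [norm_mul, Real.norm_eq_abs, Real.norm_eq_abs, abs_of_nonpos hneg]
    exact mul_le_of_le_one_right (neg_nonneg.2 hneg) (Real.abs_sin_le_one t)
  rw [intervalIntegral.integral_neg, intervalIntegral.integral_eq_sub_of_hasDerivAt
    (fun t _ ↦ hexp t) ((by fun_prop : Continuous _).intervalIntegrable _ _)] at hbound
  have hT' : |Real.exp (-s * T ^ 2) * Real.sin T| ≤ Real.exp (-s * T ^ 2) := by
    rw [abs_mul, Real.abs_exp]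
    exact mul_le_of_le_one_right (Real.exp_pos _).le (Real.abs_sin_le_one T)
  simp_rw [mul_comm (Real.cos _)]
  rw [hparts]
  simp only [Real.sin_zero, mul_zero, sub_zero]
  refine (abs_sub _ _).trans ?_
  simp at hbound hT' ⊢
  linarith

theorem tendsto_intervalIntegral_cos_mul_exp_neg_mul_sq {s : ℝ} (hs : 0 < s) :
    Tendsto (fun T ↦ ∫ t in (0 : ℝ)..T, Real.cos t * Real.exp (-s * t ^ 2)) atTop
      (nhds (√(Real.pi / s) / 2 * Real.exp (-1 / (4 * s)))) := by
  rw [← integral_Ioi_cos_mul_exp_neg_mul_sq hs]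
  exact intervalIntegral_tendsto_integral_Ioi 0 (integrableOn_cos_mul_exp_neg_mul_sq hs) tendsto_id

theorem intervalIntegral_cos_div_rpow {μ x T : ℝ} (hμ : 0 < μ) (hx : 0 < x) (hT : 0 ≤ T) :
    (2 * x) ^ μ * Real.Gamma μ * ∫ t in (0 : ℝ)..T, Real.cos t / (x ^ 2 + t ^ 2) ^ μ =
      ∫ u in Ioi (0 : ℝ), u ^ (μ - 1) * Real.exp (-(x / 2 * u)) *
        ∫ t in (0 : ℝ)..T, Real.cos t * Real.exp (-(u / (2 * x)) * t ^ 2) := by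
  have hcongr (t : ℝ) : (2 * x) ^ μ * Real.Gamma μ * (Real.cos t / (x ^ 2 + t ^ 2) ^ μ) =
      ∫ u in Ioi (0 : ℝ), u ^ (μ - 1) * Real.exp (-(x / 2 * u)) *
        (Real.cos t * Real.exp (-(u / (2 * x)) * t ^ 2)) := by
    have hr : 0 < (x ^ 2 + t ^ 2) / (2 * x) := by positivity
    calc
      _ = Real.cos t * ((1 / ((x ^ 2 + t ^ 2) / (2 * x))) ^ μ * Real.Gamma μ) := by
        rw [one_div_div, Real.div_rpow (by positivity) (by positivity)]
        ring
      _ = _ := by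
        rw [← Real.integral_rpow_mul_exp_neg_mul_Ioi hμ hr, ← integral_const_mul]
        refine integral_congr_ae (.of_forall fun u ↦ ?_)
        have : -((x ^ 2 + t ^ 2) / (2 * x) * u) = -(x / 2 * u) + -(u / (2 * x)) * t ^ 2 := by
          field_simp
          ring
        simp only
        rw [this, Real.exp_add]
        ring
  have hInt : IntegrableOn (fun u ↦ u ^ (μ - 1) * Real.exp (-(x / 2 * u))) (Ioi 0) := by
    refine Integrable.of_integral_ne_zero ?_
    rw [Real.integral_rpow_mul_exp_neg_mul_Ioi hμ (by positivity)]
    have := Real.Gamma_pos_of_pos hμ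
    positivity
  rw [← intervalIntegral.integral_const_mul]
  simp only [hcongr, intervalIntegral.integral_of_le hT]
  rw [integral_integral_swap]
  · simp only [integral_const_mul]
  · refine Integrable.mono (hInt.comp_snd (volume.restrict (Ioc 0 T))) ?_ ?_
    · exact Measurable.aestronglyMeasurable (by unfold Function.uncurry; fun_prop)
    · have : ∀ᵐ z ∂(volume.restrict (Ioc 0 T)).prod (volume.restrict (Ioi (0 : ℝ))),
          z.2 ∈ Ioi (0 : ℝ) :=
        Measure.quasiMeasurePreserving_snd.ae (ae_restrict_mem measurableSet_Ioi)
      filter_upwards [this] with z hz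
      have hz : 0 < z.2 := hz
      simp only [Function.uncurry, norm_mul (_ * _)]
      refine mul_le_of_le_one_right (norm_nonneg _) ?_
      rw [norm_mul, Real.norm_eq_abs, Real.norm_eq_abs, Real.abs_exp]
      refine mul_le_one₀ (Real.abs_cos_le_one _) (Real.exp_pos _).le (Real.exp_le_one_iff.2 ?_)
      have : 0 ≤ z.2 / (2 * x) * z.1 ^ 2 := by positivity
      linarith

/-- The integrand of `K_ν(x) = ½ ∫₀^∞ u ^ (ν - 1) exp (-x (u + 1 / u) / 2) du`. -/
noncomputable def besselKIntegrand (ν x u : ℝ) : ℝ :=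
  1 / 2 * u ^ (ν - 1) * Real.exp (-(u + u⁻¹) / 2 * x)

theorem measurable_besselKIntegrand (ν : ℝ) :
    Measurable (Function.uncurry (besselKIntegrand ν)) := by
  unfold besselKIntegrand Function.uncurry
  fun_prop

theorem besselKIntegrand_nonneg {ν x u : ℝ} (hu : 0 ≤ u) : 0 ≤ besselKIntegrand ν x u := by
  unfold besselKIntegrand
  positivity

theorem lintegral_besselK_mul {ν lam : ℝ} (hν1 : -1/2 < ν) (hν2 : ν < 1/2)
    (hlam1 : -1/2 < lam) (hlam2 : lam < 1/2) :
    ∫⁻ x in Ioi (0 : ℝ),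
      (∫⁻ u in Ioi (0 : ℝ), ENNReal.ofReal (besselKIntegrand ν x u)) *
        ∫⁻ v in Ioi (0 : ℝ), ENNReal.ofReal (besselKIntegrand lam x v) =
    ENNReal.ofReal (Real.pi ^ 2 / (4 * Real.cos (Real.pi * (lam + ν) / 2) *
      Real.cos (Real.pi * (lam - ν) / 2))) := by
  have hsum : Real.sin (Real.pi * ((ν + lam + 1) / 2)) = Real.cos (Real.pi * (lam + ν) / 2) := by
    rw [← Real.sin_add_pi_div_two]; ring_nf
  have hdiff : Real.sin (Real.pi * ((lam - (ν + lam + 1) / 2 + 1) / 1)) =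
      Real.cos (Real.pi * (lam - ν) / 2) := by
    rw [← Real.sin_add_pi_div_two]; ring_nf
  have hC : 0 < Real.cos (Real.pi * (lam + ν) / 2) :=
    Real.cos_pos_of_mem_Ioo ⟨by nlinarith [Real.pi_pos], by nlinarith [Real.pi_pos]⟩
  set C := Real.cos (Real.pi * (lam + ν) / 2)
  let F : ℝ → ℝ → ℝ → ℝ := fun x u w ↦ u * besselKIntegrand ν x u * besselKIntegrand lam x (u * w)
  have hF : Measurable fun z : (ℝ × ℝ) × ℝ ↦ ENNReal.ofReal (F z.1.1 z.1.2 z.2) := by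
    unfold F besselKIntegrand
    fun_prop
  calc
    _ = ∫⁻ x in Ioi (0 : ℝ), ∫⁻ u in Ioi (0 : ℝ), ∫⁻ w in Ioi (0 : ℝ),
          ENNReal.ofReal (F x u w) := by
      refine lintegral_congr fun x ↦ ?_
      rw [← lintegral_mul_const _
        ((measurable_besselKIntegrand ν).of_uncurry_left (x := x)).ennreal_ofReal]
      refine setLIntegral_congr_fun measurableSet_Ioi fun u (hu : 0 < u) ↦ ?_
      have h1 : 0 ≤ besselKIntegrand ν x u := besselKIntegrand_nonneg hu.le
      rw [setLIntegral_Ioi_eq_mul_comp_mul_left _ hu, ← mul_assoc, ← ENNReal.ofReal_mul h1,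
        ← lintegral_const_mul' _ _ ENNReal.ofReal_ne_top]
      refine lintegral_congr fun w ↦ ?_
      rw [← ENNReal.ofReal_mul (by positivity)]
      simp only [F]
      ring_nf
    _ = ∫⁻ w in Ioi (0 : ℝ), ∫⁻ u in Ioi (0 : ℝ), ∫⁻ x in Ioi (0 : ℝ),
          ENNReal.ofReal (F x u w) := by
      rw [lintegral_lintegral_swap hF.lintegral_prod_right'.aemeasurable,
        lintegral_lintegral_swap (f := fun w u ↦ ∫⁻ x in Ioi (0 : ℝ), ENNReal.ofReal (F x u w))]
      · refine lintegral_congr fun u ↦ lintegral_lintegral_swap ?_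
        exact (hF.comp (f := fun z : ℝ × ℝ ↦ ((z.1, u), z.2)) (by fun_prop)).aemeasurable
      · exact (hF.comp (f := fun z : (ℝ × ℝ) × ℝ ↦ ((z.2, z.1.2), z.1.1))
          (by fun_prop)).lintegral_prod_right'.aemeasurable
    _ = ∫⁻ w in Ioi (0 : ℝ), ENNReal.ofReal (1 / 4 * (Real.pi / C)) *
          ENNReal.ofReal (w ^ (lam - (ν + lam + 1) / 2) / (1 + 1 * w ^ (1 : ℝ))) := by
      refine setLIntegral_congr_fun measurableSet_Ioi fun w (hw : 0 < w) ↦ ?_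
      have hx : ∀ u ∈ Ioi (0 : ℝ), ∫⁻ x in Ioi (0 : ℝ), ENNReal.ofReal (F x u w) =
          ENNReal.ofReal (1 / 2 * w ^ lam / (1 + w)) *
            ENNReal.ofReal (u ^ (ν + lam) / (1 + w * u ^ (2 : ℝ))) := by
        intro u (hu : 0 < u)
        have hb : 0 < (u + u⁻¹ + (u * w) + (u * w)⁻¹) / 2 := by positivity
        have hFx : ∀ x, F x u w = 1 / 4 * u * u ^ (ν - 1) * (u * w) ^ (lam - 1) *
            Real.exp (-((u + u⁻¹ + (u * w) + (u * w)⁻¹) / 2) * x) := by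
          intro x
          have : -((u + u⁻¹ + (u * w) + (u * w)⁻¹) / 2) * x =
            (-(u + u⁻¹) / 2 * x) + (-(u * w + (u * w)⁻¹) / 2 * x) := by ring
          rw [this, Real.exp_add]
          simp only [F, besselKIntegrand]
          ring
        simp only [hFx]
        simp_rw [ENNReal.ofReal_mul (show 0 ≤ 1 / 4 * u * u ^ (ν - 1) * (u * w) ^ (lam - 1) by
          positivity)]
        rw [lintegral_const_mul' _ _ ENNReal.ofReal_ne_top, setLIntegral_exp_neg_mul hb,
          ← ENNReal.ofReal_mul (by positivity), ← ENNReal.ofReal_mul (by positivity),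
          Real.mul_rpow hu.le hw.le, Real.rpow_sub_one hu.ne', Real.rpow_sub_one hu.ne',
          Real.rpow_sub_one hw.ne', Real.rpow_add hu, Real.rpow_two]
        congr 1
        field_simp
        ring
      rw [setLIntegral_congr_fun measurableSet_Ioi hx,
        lintegral_const_mul' _ _ ENNReal.ofReal_ne_top,
        setLIntegral_rpow_div_one_add_mul_rpow (by linarith) (by linarith) hw, hsum,
        ← ENNReal.ofReal_mul (by positivity), ← ENNReal.ofReal_mul (by positivity), sub_eq_add_neg,
        Real.rpow_add hw, Real.rpow_one, neg_div]
      ring_nf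
    _ = _ := by
      rw [lintegral_const_mul' _ _ ENNReal.ofReal_ne_top,
        setLIntegral_rpow_div_one_add_mul_rpow (by linarith) (by linarith) one_pos,
        ← ENNReal.ofReal_mul (by positivity), hdiff, Real.one_rpow]
      congr 1
      ring

theorem besselKIntegrand_eq {ν x u : ℝ} (hx : 0 < x) (hu : 0 < u) :
    u ^ (ν + 1 / 2 - 1) * Real.exp (-(x / 2 * u)) *
      (√(Real.pi / (u / (2 * x))) / 2 * Real.exp (-1 / (4 * (u / (2 * x))))) =
    √Real.pi * (2 * x) ^ (1 / 2 : ℝ) * besselKIntegrand ν x u := by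
  have hsplit : -(u + u⁻¹) / 2 * x = -(x / 2 * u) + -1 / (4 * (u / (2 * x))) := by
    field_simp
    ring
  have hpow : u ^ (ν - 1) = u ^ (ν + 1 / 2 - 1) * (u ^ (1 / 2 : ℝ))⁻¹ := by
    rw [← Real.rpow_neg hu.le, ← Real.rpow_add hu]
    ring_nf
  rw [besselKIntegrand, hsplit, hpow, Real.exp_add, ← Real.sqrt_eq_rpow, ← Real.sqrt_eq_rpow,
    div_div_eq_mul_div, Real.sqrt_div (by positivity), Real.sqrt_mul (by positivity)]
  ring

theorem besselK_integral_representation {ν x : ℝ} (hν : -1/2 < ν) (hx : 0 < x) :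
    IntegrableOn (besselKIntegrand ν x) (Ioi 0) ∧
    Tendsto (fun T ↦ ∫ t in (0 : ℝ)..T, Real.cos t / (x ^ 2 + t ^ 2) ^ (ν + 1 / 2)) atTop
      (nhds (√Real.pi * (∫ u in Ioi (0 : ℝ), besselKIntegrand ν x u) /
        (2 ^ ν * Real.Gamma (ν + 1 / 2) * x ^ ν))) := by
  have hμ : 0 < ν + 1 / 2 := by linarith
  have hG := Real.Gamma_pos_of_pos hμ
  have hInt : IntegrableOn (fun u ↦ u ^ (ν + 1 / 2 - 1) * Real.exp (-(x / 2 * u))) (Ioi 0) := by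
    refine Integrable.of_integral_ne_zero ?_
    rw [Real.integral_rpow_mul_exp_neg_mul_Ioi hμ (by positivity)]
    positivity
  have hconst : 0 < √Real.pi * (2 * x) ^ (1 / 2 : ℝ) := by
    have := Real.pi_pos
    positivity
  have hlim {u : ℝ} (hu : 0 < u) : Tendsto (fun T ↦ u ^ (ν + 1 / 2 - 1) * Real.exp (-(x / 2 * u)) *
      ∫ t in (0 : ℝ)..T, Real.cos t * Real.exp (-(u / (2 * x)) * t ^ 2)) atTop
      (nhds (√Real.pi * (2 * x) ^ (1 / 2 : ℝ) * besselKIntegrand ν x u)) := by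
    rw [← besselKIntegrand_eq hx hu]
    exact (tendsto_intervalIntegral_cos_mul_exp_neg_mul_sq (by positivity)).const_mul _
  have hbound {u T : ℝ} (hu : 0 < u) (hT : 0 ≤ T) :
      ‖u ^ (ν + 1 / 2 - 1) * Real.exp (-(x / 2 * u)) *
        ∫ t in (0 : ℝ)..T, Real.cos t * Real.exp (-(u / (2 * x)) * t ^ 2)‖ ≤
      u ^ (ν + 1 / 2 - 1) * Real.exp (-(x / 2 * u)) := by
    rw [norm_mul, Real.norm_of_nonneg (by positivity)]
    exact mul_le_of_le_one_right (by positivity)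
      (abs_intervalIntegral_cos_mul_exp_neg_mul_sq_le (by positivity) hT)
  constructor
  · have : IntegrableOn (fun u ↦ √Real.pi * (2 * x) ^ (1 / 2 : ℝ) * besselKIntegrand ν x u)
        (Ioi 0) := by
      refine hInt.mono' (Measurable.aestronglyMeasurable
        (by unfold besselKIntegrand; fun_prop)) ?_
      filter_upwards [ae_restrict_mem measurableSet_Ioi] with u hu
      exact le_of_tendsto (hlim hu).norm
        ((eventually_ge_atTop 0).mono fun T hT ↦ hbound hu hT)
    exact (integrable_const_mul_iff hconst.ne'.isUnit _).1 this
  · have key : Tendsto (fun T ↦ ∫ u in Ioi (0 : ℝ), u ^ (ν + 1 / 2 - 1) *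
        Real.exp (-(x / 2 * u)) *
          ∫ t in (0 : ℝ)..T, Real.cos t * Real.exp (-(u / (2 * x)) * t ^ 2)) atTop
        (nhds (∫ u in Ioi (0 : ℝ), √Real.pi * (2 * x) ^ (1 / 2 : ℝ) * besselKIntegrand ν x u)) := by
      refine tendsto_integral_filter_of_dominated_convergence _ (.of_forall fun T ↦ ?_) ?_ hInt ?_
      · refine AEStronglyMeasurable.mul hInt.aestronglyMeasurable ?_
        refine Continuous.aestronglyMeasurable ?_
        exact intervalIntegral.continuous_parametric_intervalIntegral_of_continuous'
          (by unfold Function.uncurry; fun_prop) _ _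
      · filter_upwards [eventually_ge_atTop 0] with T hT
        filter_upwards [ae_restrict_mem measurableSet_Ioi] with u hu
        exact hbound hu hT
      · filter_upwards [ae_restrict_mem measurableSet_Ioi] with u hu
        exact hlim hu
    have hC : 0 < (2 * x) ^ (ν + 1 / 2) * Real.Gamma (ν + 1 / 2) := by positivity
    refine ((key.const_mul
      ((2 * x) ^ (ν + 1 / 2) * Real.Gamma (ν + 1 / 2))⁻¹).congr' ?_).trans_eq ?_
    · filter_upwards [eventually_ge_atTop 0] with T hT
      rw [← intervalIntegral_cos_div_rpow hμ hx hT, inv_mul_cancel_left₀ hC.ne']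
    · congr 1
      rw [integral_const_mul, Real.rpow_add (by positivity) ν,
        Real.mul_rpow zero_le_two hx.le (z := ν)]
      field_simp

theorem stmt_18 (K : ℝ → ℝ → ℝ)
    (hK : ∀ ν : ℝ, -1/2 < ν → ∀ x : ℝ, 0 < x →
      Tendsto (fun T => ∫ t in (0:ℝ)..T, Real.cos t / (x ^ 2 + t ^ 2) ^ (ν + 1/2))
        atTop
        (nhds (Real.sqrt Real.pi * K ν x /
          ((2 : ℝ) ^ ν * Real.Gamma (ν + 1/2) * x ^ ν))))
    (a ν lam : ℝ) (ha : 0 < a)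
    (hν1 : -1/2 < ν) (hν2 : ν < 1/2) (hν0 : ν ≠ 0)
    (hlam1 : -1/2 < lam) (hlam2 : lam < 1/2) :
    ∫ x in Ioi (0:ℝ), K ν (a * x) * K lam (a * x) =
      (Real.pi ^ 2 / (4 * a * Real.sin (Real.pi * ν))) *
        (Real.tan (Real.pi * (lam + ν) / 2) - Real.tan (Real.pi * (lam - ν) / 2)) := by
  let L (μ x : ℝ) : ℝ≥0∞ := ∫⁻ u in Ioi (0 : ℝ), ENNReal.ofReal (besselKIntegrand μ x u)
  have hL {μ x : ℝ} (hμ : -1/2 < μ) (hx : 0 < x) : L μ x < ∞ ∧ (L μ x).toReal = K μ x := by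
    obtain ⟨hInt, hlim⟩ := besselK_integral_representation hμ hx
    have hG := Real.Gamma_pos_of_pos (show 0 < μ + 1 / 2 by linarith)
    have hπ := Real.sqrt_pos.2 Real.pi_pos
    have heq := tendsto_nhds_unique (hK μ hμ x hx) hlim
    rw [div_left_inj' (by positivity), mul_right_inj' hπ.ne'] at heq
    have hnn : 0 ≤ᵐ[volume.restrict (Ioi 0)] besselKIntegrand μ x := by
      filter_upwards [ae_restrict_mem measurableSet_Ioi] with u hu
      exact besselKIntegrand_nonneg (le_of_lt hu)
    have hof : L μ x = ENNReal.ofReal (∫ u in Ioi (0 : ℝ), besselKIntegrand μ x u) :=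
      (ofReal_integral_eq_lintegral_ofReal hInt hnn).symm
    rw [hof, heq]
    exact ⟨ENNReal.ofReal_lt_top, ENNReal.toReal_ofReal (integral_nonneg_of_ae hnn)⟩
  have hLmeas (μ : ℝ) : Measurable (L μ) :=
    (measurable_besselKIntegrand μ).ennreal_ofReal.lintegral_prod_right'
  have hcos1 : 0 < Real.cos (Real.pi * (lam + ν) / 2) :=
    Real.cos_pos_of_mem_Ioo ⟨by nlinarith [Real.pi_pos], by nlinarith [Real.pi_pos]⟩
  have hcos2 : 0 < Real.cos (Real.pi * (lam - ν) / 2) :=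
    Real.cos_pos_of_mem_Ioo ⟨by nlinarith [Real.pi_pos], by nlinarith [Real.pi_pos]⟩
  have hsin : Real.sin (Real.pi * ν) ≠ 0 := by
    rcases hν0.lt_or_gt with h | h
    · exact (Real.sin_neg_of_neg_of_neg_pi_lt (by nlinarith [Real.pi_pos])
        (by nlinarith [Real.pi_pos])).ne
    · exact (Real.sin_pos_of_pos_of_lt_pi (by positivity) (by nlinarith [Real.pi_pos])).ne'
  have htan : Real.tan (Real.pi * (lam + ν) / 2) - Real.tan (Real.pi * (lam - ν) / 2) =
      Real.sin (Real.pi * ν) /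
        (Real.cos (Real.pi * (lam + ν) / 2) * Real.cos (Real.pi * (lam - ν) / 2)) := by
    rw [show Real.pi * ν = Real.pi * (lam + ν) / 2 - Real.pi * (lam - ν) / 2 by ring,
      Real.sin_sub, Real.tan_eq_sin_div_cos, Real.tan_eq_sin_div_cos,
      div_sub_div _ _ hcos1.ne' hcos2.ne']
  have hunit : ∫ x in Ioi (0 : ℝ), K ν x * K lam x =
      Real.pi ^ 2 / (4 * Real.cos (Real.pi * (lam + ν) / 2) *
        Real.cos (Real.pi * (lam - ν) / 2)) := by
    calc
      _ = ∫ x in Ioi (0 : ℝ), (L ν x * L lam x).toReal := by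
        refine setIntegral_congr_fun measurableSet_Ioi fun x hx ↦ ?_
        simp only [ENNReal.toReal_mul, (hL hν1 hx).2, (hL hlam1 hx).2]
      _ = (∫⁻ x in Ioi (0 : ℝ), L ν x * L lam x).toReal := by
        refine integral_toReal ((hLmeas ν).mul (hLmeas lam)).aemeasurable ?_
        filter_upwards [ae_restrict_mem measurableSet_Ioi] with x hx
        exact ENNReal.mul_lt_top (hL hν1 hx).1 (hL hlam1 hx).1
      _ = _ := by
        rw [lintegral_besselK_mul hν1 hν2 hlam1 hlam2, ENNReal.toReal_ofReal (by positivity)]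
  rw [integral_comp_mul_left_Ioi (fun x ↦ K ν x * K lam x) 0 ha, mul_zero, hunit, htan,
    smul_eq_mul]
  field_simp
end
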